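/- arXiv:2010.15257 — 9 statements merged into one kernel-verified Lean document; each statement's English description precedes it below -/
import Mathlib

section
/- Let h₁, h₂ ∈ ℝ³ ∖ {0}, m₁ ∈ ℝ, and Z₁ ∈ ℝ³ with ⟨h₁, Z₁⟩ = 1 and ⟨h₂, Z₁⟩ > 0. Set Z₂ = Z₁ / ⟨h₂, Z₁⟩, m₂ = m₁ ⟨h₂, Z₁⟩, and N(v) = ‖v − ⟨h₁, v⟩ Z₁‖ for v ∈ ℝ³. Let q₁ : I → ℝ³ be a C² curve with ⟨h₁, q₁(t)⟩ = 1, ⟨h₂, q₁(t)⟩ > 0 and q₁(t) ≠ Z₁ for all t ∈ I, satisfying the Kepler–Coulomb equation q̈₁ = −m₁ ‖q₁ − Z₁‖^{−3} (q₁ − Z₁). Let τ ↦ t(τ) solve dt/dτ = ⟨h₂, q₁(t)⟩² and define q₂(τ) = q₁(t(τ)) / ⟨h₂, q₁(t(τ))⟩. Then ⟨h₂, q₂(τ)⟩ = 1 for all τ, N(q₂(τ) − Z₂) > 0, and q₂ satisfies d²q₂/dτ² = −m₂ N(q₂ − Z₂)^{−3} (q₂ − Z₂). (Central projection from the plane {⟨h₁,q⟩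 = 1} to the plane {⟨h₂,q⟩ = 1} sends the Kepler–Coulomb problem with mass m₁ and center Z₁ to the Kepler–Coulomb problem with mass m₂ and center Z₂, relative to the norm N.) -/
open scoped RealInnerProductSpace

/-- Central projection from the plane `{⟨h₁,q⟩ = 1}` to the plane `{⟨h₂,q⟩ = 1}` sends the
Kepler–Coulomb problem with mass `m₁` and center `Z₁` to the Kepler–Coulomb problem with
mass `m₂ = m₁⟨h₂,Z₁⟩` and center `Z₂ = Z₁/⟨h₂,Z₁⟩`, relative to the norm
`N v = ‖v - ⟨h₁,v⟩ Z₁‖`, after the time change `dt/dτ = ⟨h₂, q₁(t)⟩²`. -/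
theorem plane_to_plane_projection_kepler
    (h₁ h₂ Z₁ : EuclideanSpace ℝ (Fin 3)) (m₁ : ℝ)
    (hh₁ : h₁ ≠ 0) (hh₂ : h₂ ≠ 0)
    (hZ₁mem : ⟪h₁, Z₁⟫ = 1) (hZ₁pos : 0 < ⟪h₂, Z₁⟫)
    (Z₂ : EuclideanSpace ℝ (Fin 3)) (hZ₂ : Z₂ = (⟪h₂, Z₁⟫)⁻¹ • Z₁)
    (m₂ : ℝ) (hm₂ : m₂ = m₁ * ⟪h₂, Z₁⟫)
    (N : EuclideanSpace ℝ (Fin 3) → ℝ) (hN : ∀ v, N v = ‖v - ⟪h₁, v⟫ • Z₁‖)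
    (I : Set ℝ) (hI : IsOpen I)
    (q₁ q₁' q₁'' : ℝ → EuclideanSpace ℝ (Fin 3))
    (hq₁ : ∀ t ∈ I, HasDerivAt q₁ (q₁' t) t)
    (hq₁' : ∀ t ∈ I, HasDerivAt q₁' (q₁'' t) t)
    (hplane : ∀ t ∈ I, ⟪h₁, q₁ t⟫ = 1)
    (hpos : ∀ t ∈ I, 0 < ⟪h₂, q₁ t⟫)
    (hne : ∀ t ∈ I, q₁ t ≠ Z₁)
    (hODE : ∀ t ∈ I, q₁'' t = (-m₁ / ‖q₁ t - Z₁‖ ^ 3) • (q₁ t - Z₁))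
    (J : Set ℝ) (hJ : IsOpen J)
    (t : ℝ → ℝ) (htI : ∀ τ ∈ J, t τ ∈ I)
    (ht : ∀ τ ∈ J, HasDerivAt t (⟪h₂, q₁ (t τ)⟫ ^ 2) τ)
    (q₂ : ℝ → EuclideanSpace ℝ (Fin 3))
    (hq₂ : ∀ τ, q₂ τ = (⟪h₂, q₁ (t τ)⟫)⁻¹ • q₁ (t τ)) :
    ∀ τ ∈ J,
      ⟪h₂, q₂ τ⟫ = 1 ∧
      0 < N (q₂ τ - Z₂) ∧
      deriv (deriv q₂) τ = (-m₂ / N (q₂ τ - Z₂) ^ 3) • (q₂ τ - Z₂) := by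
  have hd1 : ∀ τ ∈ J, HasDerivAt (fun s => q₁ (t s)) ((⟪h₂, q₁ (t τ)⟫ ^ 2) • q₁' (t τ)) τ :=
    fun τ hτ => (hq₁ _ (htI τ hτ)).scomp τ (ht τ hτ)
  have hd2 : ∀ τ ∈ J, HasDerivAt (fun s => q₁' (t s)) ((⟪h₂, q₁ (t τ)⟫ ^ 2) • q₁'' (t τ)) τ :=
    fun τ hτ => (hq₁' _ (htI τ hτ)).scomp τ (ht τ hτ)
  have hin : ∀ (f : ℝ → EuclideanSpace ℝ (Fin 3)) (f' : EuclideanSpace ℝ (Fin 3)) (τ : ℝ),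
      HasDerivAt f f' τ → HasDerivAt (fun s => ⟪h₂, f s⟫) ⟪h₂, f'⟫ τ := by
    intro f f' τ hf
    simpa using (hasDerivAt_const τ h₂).inner ℝ hf
  have hD : ∀ τ ∈ J, HasDerivAt q₂
      (⟪h₂, q₁ (t τ)⟫ • q₁' (t τ) - ⟪h₂, q₁' (t τ)⟫ • q₁ (t τ)) τ := by
    intro τ hτ
    have ha := (hpos _ (htI τ hτ)).ne'
    have e : q₂ = fun s => (⟪h₂, q₁ (t s)⟫)⁻¹ • q₁ (t s) := funext hq₂
    rw [e]
    have h := ((hin _ _ τ (hd1 τ hτ)).fun_inv ha).fun_smul (hd1 τ hτ)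
    refine h.congr_deriv ?_
    rw [inner_smul_right]
    match_scalars <;> field_simp
  intro τ hτ
  have ha := hpos _ (htI τ hτ)
  have hp := hplane _ (htI τ hτ)
  have hq := hne _ (htI τ hτ)
  have ho := hODE _ (htI τ hτ)
  have hr : 0 < ‖q₁ (t τ) - Z₁‖ := norm_pos_iff.2 (sub_ne_zero.2 hq)
  have hNv : N (q₂ τ - Z₂) = ‖q₁ (t τ) - Z₁‖ / ⟪h₂, q₁ (t τ)⟫ := by
    have e : q₂ τ - Z₂ - ⟪h₁, q₂ τ - Z₂⟫ • Z₁ = (⟪h₂, q₁ (t τ)⟫)⁻¹ • (q₁ (t τ) - Z₁) := by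
      rw [hq₂, hZ₂, inner_sub_right, inner_smul_right, inner_smul_right, hp, hZ₁mem]
      module
    rw [hN, e, norm_smul, norm_inv, Real.norm_of_nonneg ha.le]
    ring
  refine ⟨?_, ?_, ?_⟩
  · rw [hq₂, inner_smul_right]
    exact inv_mul_cancel₀ ha.ne'
  · rw [hNv]
    positivity
  · have hev : deriv q₂ =ᶠ[nhds τ] fun s =>
        ⟪h₂, q₁ (t s)⟫ • q₁' (t s) - ⟪h₂, q₁' (t s)⟫ • q₁ (t s) := by
      filter_upwards [hJ.mem_nhds hτ] with s hs using (hD s hs).deriv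
    rw [hev.deriv_eq]
    have h := ((hin _ _ τ (hd1 τ hτ)).fun_smul (hd2 τ hτ)).fun_sub
      ((hin _ _ τ (hd2 τ hτ)).fun_smul (hd1 τ hτ))
    rw [h.deriv, hNv, ho, hm₂, hq₂, hZ₂]
    simp only [inner_smul_right, inner_sub_right]
    generalize ⟪h₂, q₁ (t τ)⟫ = a at *
    generalize ⟪h₂, Z₁⟫ = c at *
    generalize ‖q₁ (t τ) - Z₁‖ = r at *
    have h1 := ha.ne'
    have h2 := hr.ne'
    have h3 := hZ₁pos.ne'
    match_scalars <;> field_simp <;> ring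
end

section
/- Let m ∈ ℝ and Z = (0,0,−1) ∈ ℝ³. Let q₁ : I → ℝ³ be a C² curve of the form q₁(t) = (x(t), y(t), −1) with q₁(t) ≠ Z for all t, satisfying the planar Kepler–Coulomb equation q̈₁ = −m ‖q₁ − Z‖^{−3} (q₁ − Z). Let τ ↦ t(τ) solve dt/dτ = ‖q₁(t)‖² and define q₂(τ) = q₁(t(τ)) / ‖q₁(t(τ))‖ ∈ S². Then q₂ solves the spherical Kepler–Coulomb equation with mass factor m and center Z: q₂'' = −|q₂'|² q₂ + m (1 − ⟨q₂, Z⟩²)^{−3/2} (Z − ⟨q₂, Z⟩ q₂). (Central projection sends the planar Kepler–Coulomb problem on the plane {z = −1} with center at the south pole to the spherical Kepler–Coulomb problem on the southern hemisphere with the same mass factor and center.) -/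
open scoped RealInnerProductSpace

/-- Central projection sends the planar Kepler–Coulomb problem on the plane `{z = -1}`
with center at the south pole `Z = (0,0,-1)` and mass factor `m` to the spherical
Kepler–Coulomb problem on the southern hemisphere with the same mass factor and center,
after the time change `dt/dτ = ‖q₁(t)‖²`. -/
theorem plane_to_sphere_projection_kepler
    (m : ℝ) (Z : EuclideanSpace ℝ (Fin 3))
    (hZ : Z = EuclideanSpace.single 2 (-1 : ℝ))
    (I : Set ℝ) (hI : IsOpen I)
    (q₁ q₁' q₁'' : ℝ → EuclideanSpace ℝ (Fin 3))
    (hq₁ : ∀ t ∈ I, HasDerivAt q₁ (q₁' t) t)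
    (hq₁' : ∀ t ∈ I, HasDerivAt q₁' (q₁'' t) t)
    (hplane : ∀ t ∈ I, q₁ t 2 = -1)
    (hne : ∀ t ∈ I, q₁ t ≠ Z)
    (hODE : ∀ t ∈ I, q₁'' t = (-m / ‖q₁ t - Z‖ ^ 3) • (q₁ t - Z))
    (J : Set ℝ) (hJ : IsOpen J)
    (t : ℝ → ℝ) (htI : ∀ τ ∈ J, t τ ∈ I)
    (ht : ∀ τ ∈ J, HasDerivAt t (‖q₁ (t τ)‖ ^ 2) τ)
    (q₂ : ℝ → EuclideanSpace ℝ (Fin 3))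
    (hq₂ : ∀ τ, q₂ τ = (‖q₁ (t τ)‖)⁻¹ • q₁ (t τ)) :
    ∀ τ ∈ J,
      deriv (deriv q₂) τ =
        -(‖deriv q₂ τ‖ ^ 2) • q₂ τ +
          (m * (1 - ⟪q₂ τ, Z⟫ ^ 2) ^ (-(3 : ℝ) / 2)) • (Z - ⟪q₂ τ, Z⟫ • q₂ τ) := by
  intro τ hτ
  have hqZ : ∀ s ∈ I, ⟪q₁ s, Z⟫ = 1 := by
    intro s hs
    rw [hZ, EuclideanSpace.inner_single_right, hplane s hs]
    simp
  have hZZ : ⟪Z, Z⟫ = 1 := by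
    rw [hZ, EuclideanSpace.inner_single_right]
    simp
  have hpos : ∀ s ∈ I, 0 < ‖q₁ s‖ := by
    intro s hs
    rw [norm_pos_iff]
    intro h
    have := hqZ s hs
    rw [h, inner_zero_left] at this
    norm_num at this
  have hQ : ∀ σ ∈ J, HasDerivAt (fun σ => q₁ (t σ)) (‖q₁ (t σ)‖ ^ 2 • q₁' (t σ)) σ :=
    fun σ hσ => (hq₁ _ (htI σ hσ)).scomp σ (ht σ hσ)
  have hV : ∀ σ ∈ J, HasDerivAt (fun σ => q₁' (t σ)) (‖q₁ (t σ)‖ ^ 2 • q₁'' (t σ)) σ :=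
    fun σ hσ => (hq₁' _ (htI σ hσ)).scomp σ (ht σ hσ)
  have hR : ∀ σ ∈ J, HasDerivAt (fun σ => ‖q₁ (t σ)‖)
      (‖q₁ (t σ)‖ * ⟪q₁ (t σ), q₁' (t σ)⟫) σ := by
    intro σ hσ
    have hp := hpos _ (htI σ hσ)
    have h1 := (hQ σ hσ).norm_sq.sqrt (by positivity)
    simp only [Real.sqrt_sq (norm_nonneg _)] at h1
    convert h1 using 1
    rw [inner_smul_right]
    field_simp
  have hD : ∀ σ ∈ J, HasDerivAt q₂ (‖q₁ (t σ)‖ • q₁' (t σ)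
      - (⟪q₁ (t σ), q₁' (t σ)⟫ * ‖q₁ (t σ)‖⁻¹) • q₁ (t σ)) σ := by
    intro σ hσ
    have hp := hpos _ (htI σ hσ)
    have h1 := ((hR σ hσ).fun_inv hp.ne').fun_smul (hQ σ hσ)
    rw [show q₂ = fun σ => (‖q₁ (t σ)‖)⁻¹ • q₁ (t σ) from funext hq₂]
    refine h1.congr_deriv ?_
    match_scalars <;> field_simp
  have hdd : deriv q₂ =ᶠ[nhds τ] fun σ => ‖q₁ (t σ)‖ • q₁' (t σ)
      - (⟪q₁ (t σ), q₁' (t σ)⟫ * ‖q₁ (t σ)‖⁻¹) • q₁ (t σ) := by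
    filter_upwards [hJ.mem_nhds hτ] with σ hσ using (hD σ hσ).deriv
  have hp := hpos _ (htI τ hτ)
  have h2 := ((hR τ hτ).fun_smul (hV τ hτ)).fun_sub
    ((((hQ τ hτ).inner ℝ (hV τ hτ)).fun_mul ((hR τ hτ).fun_inv hp.ne')).fun_smul (hQ τ hτ))
  rw [hdd.deriv_eq, h2.deriv, (hD τ hτ).deriv, hq₂ τ, hODE _ (htI τ hτ)]
  have hqz := hqZ _ (htI τ hτ)
  have hn := hne _ (htI τ hτ)
  generalize q₁' (t τ) = v at *
  generalize q₁ (t τ) = q at *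
  clear h2 hdd hD hR hV hQ
  have hd : 0 < ‖q - Z‖ := norm_pos_iff.2 (sub_ne_zero.2 hn)
  have hd2 : ‖q - Z‖ ^ 2 = ‖q‖ ^ 2 - 1 := by
    rw [norm_sub_sq_real, hqz, ← real_inner_self_eq_norm_sq Z, hZZ]; ring
  have hqq : ⟪q, q⟫ = ‖q‖ ^ 2 := real_inner_self_eq_norm_sq q
  have hvv : ⟪v, v⟫ = ‖v‖ ^ 2 := real_inner_self_eq_norm_sq v
  have hvq : ⟪v, q⟫ = ⟪q, v⟫ := real_inner_comm _ _
  have hpow : (1 - (‖q‖⁻¹ * 1) ^ 2) ^ (-(3 : ℝ) / 2) = ‖q‖ ^ 3 / ‖q - Z‖ ^ 3 := by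
    have e : 1 - (‖q‖⁻¹ * 1) ^ 2 = (‖q - Z‖ / ‖q‖) ^ 2 := by
      rw [div_pow, hd2]; field_simp
    rw [e, ← Real.rpow_natCast, ← Real.rpow_mul (by positivity),
      show ((2 : ℕ) : ℝ) * (-(3 : ℝ) / 2) = -((3 : ℕ) : ℝ) by norm_num,
      Real.rpow_neg (by positivity), Real.rpow_natCast, div_pow, inv_div]
  have hnorm : ‖‖q‖ • v - (⟪q, v⟫ * ‖q‖⁻¹) • q‖ ^ 2 = ‖q‖ ^ 2 * ‖v‖ ^ 2 - ⟪q, v⟫ ^ 2 := by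
    rw [← real_inner_self_eq_norm_sq]
    simp only [inner_sub_left, inner_sub_right, real_inner_smul_left, real_inner_smul_right,
      hqq, hvv, hvq]
    field_simp
    ring
  rw [hnorm]
  simp only [inner_sub_left, inner_sub_right, real_inner_smul_left, real_inner_smul_right,
      hqq, hvv, hvq, hqz]
  rw [hpow]
  generalize ‖q - Z‖ = d at *
  match_scalars <;> field_simp <;> ring
end

section
/- Let a, m ∈ ℝ and Z₁ = (0, a/√(1+a²), −1/√(1+a²)) ∈ S². Let (ξ, η) : I → ℝ² ∖ {(0,0)} be a C² solution of the planar Kepler–Coulomb ODE with mass factor m: ξ̈ = −m ξ (ξ²+η²)^{−3/2}, η̈ = −m η (ξ²+η²)^{−3/2}. Define x = ξ, y = √(1+a²) η + a, and q₁(t) = (x(t), y(t), −1) ∈ ℝ³. Let τ ↦ t(τ) solve dt/dτ = ‖q₁(t)‖² and define q₂(τ) = q₁(t(τ)) / ‖q₁(t(τ))‖ ∈ S². Then q₂ solves the spherical Kepler–Coulomb equation with mass factor m√(1+a²) and center Z₁: q₂'' = −|q₂'|² q₂ + m√(1+a²) (1 − ⟨q₂, Z₁⟩²)^{−3/2} (Z₁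 − ⟨q₂, Z₁⟩ q₂). (The planar Kepler–Coulomb problem with mass factor m and center (0,a,−1) in the plane {z=−1} is centrally projected from the spherical Kepler–Coulomb problem with mass factor m√(1+a²) and center Z₁.) -/
open scoped RealInnerProductSpace

/-- General central projection computation. -/
lemma central_proj_aux (Q V W : ℝ → EuclideanSpace ℝ (Fin 3)) (I J : Set ℝ) (hJ : IsOpen J)
    (hQ : ∀ t ∈ I, HasDerivAt Q (V t) t) (hV : ∀ t ∈ I, HasDerivAt V (W t) t)
    (h0 : ∀ t, Q t ≠ 0)
    (t : ℝ → ℝ) (htI : ∀ τ ∈ J, t τ ∈ I)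
    (ht : ∀ τ ∈ J, HasDerivAt t (‖Q (t τ)‖ ^ 2) τ)
    (q : ℝ → EuclideanSpace ℝ (Fin 3))
    (hq : ∀ τ, q τ = (‖Q (t τ)‖)⁻¹ • Q (t τ)) (τ : ℝ) (hτ : τ ∈ J) :
    deriv (deriv q) τ = -(‖deriv q τ‖ ^ 2) • q τ +
      (‖Q (t τ)‖ ^ 3 • W (t τ) - (‖Q (t τ)‖ * ⟪Q (t τ), W (t τ)⟫) • Q (t τ)) := by
  have hr : ∀ u ∈ I, HasDerivAt (fun u => ‖Q u‖) (⟪Q u, V u⟫ / ‖Q u‖) u := by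
    intro u hu
    have h1 := ((hQ u hu).norm_sq).sqrt (by have := norm_pos_iff.2 (h0 u); positivity)
    simp only [Real.sqrt_sq (norm_nonneg _)] at h1
    refine h1.congr_deriv ?_
    have := norm_pos_iff.2 (h0 u)
    field_simp
  have hd : ∀ σ ∈ J, HasDerivAt q (‖Q (t σ)‖ • V (t σ) -
      (⟪Q (t σ), V (t σ)⟫ / ‖Q (t σ)‖) • Q (t σ)) σ := by
    intro σ hσ
    have hu := htI σ hσ
    have hp := norm_pos_iff.2 (h0 (t σ))
    have h1 := ((hr _ hu).inv hp.ne').smul (hQ _ hu)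
    have h2 := h1.scomp σ (ht σ hσ)
    have e : q = (fun u => ‖Q u‖⁻¹ • Q u) ∘ t := funext hq
    rw [e]
    refine h2.congr_deriv ?_
    ext i
    simp
    field_simp
    ring
  have hd2 : HasDerivAt (fun σ => ‖Q (t σ)‖ • V (t σ) -
      (⟪Q (t σ), V (t σ)⟫ / ‖Q (t σ)‖) • Q (t σ))
      (‖Q (t τ)‖ ^ 2 • (‖Q (t τ)‖ • W (t τ) - ((⟪Q (t τ), W (t τ)⟫ + ‖V (t τ)‖ ^ 2) / ‖Q (t τ)‖
        - ⟪Q (t τ), V (t τ)⟫ ^ 2 / ‖Q (t τ)‖ ^ 3) • Q (t τ))) τ := by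
    have hu := htI τ hτ
    have hp := norm_pos_iff.2 (h0 (t τ))
    have h1 := ((hr _ hu).smul (hV _ hu)).sub
      ((((hQ _ hu).inner ℝ (hV _ hu)).div (hr _ hu) hp.ne').smul (hQ _ hu))
    have h2 := h1.scomp τ (ht τ hτ)
    refine h2.congr_deriv ?_
    rw [real_inner_self_eq_norm_sq]
    ext i
    simp
    field_simp
    ring_nf
    simp
  have e1 : deriv q =ᶠ[nhds τ] (fun σ => ‖Q (t σ)‖ • V (t σ) -
      (⟪Q (t σ), V (t σ)⟫ / ‖Q (t σ)‖) • Q (t σ)) := by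
    filter_upwards [hJ.mem_nhds hτ] with σ hσ using (hd σ hσ).deriv
  have hp := norm_pos_iff.2 (h0 (t τ))
  have e2 : ‖deriv q τ‖ ^ 2 = ‖Q (t τ)‖ ^ 2 * ‖V (t τ)‖ ^ 2 - ⟪Q (t τ), V (t τ)⟫ ^ 2 := by
    rw [(hd τ hτ).deriv, norm_sub_sq_real, norm_smul, norm_smul, inner_smul_left, inner_smul_right,
      real_inner_comm (Q (t τ)) (V (t τ)), mul_pow, mul_pow]
    simp only [Real.norm_eq_abs, sq_abs, conj_trivial, abs_norm]
    field_simp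
    ring
  rw [e1.deriv_eq, hd2.deriv, e2, hq]
  ext i
  simp
  field_simp
  ring

/-- The planar Kepler–Coulomb problem with mass factor `m` and center `(0,a,-1)` in the
plane `{z = -1}` (written in the normalized coordinates `x = ξ`, `y = √(1+a²) η + a`) is
centrally projected from the spherical Kepler–Coulomb problem with mass factor `m√(1+a²)`
and center `Z₁ = (0, a/√(1+a²), -1/√(1+a²))`. -/
theorem plane_to_sphere_projection_kepler_shifted_center
    (a m : ℝ)
    (Z₁ : EuclideanSpace ℝ (Fin 3))
    (hZ₁ : Z₁ = EuclideanSpace.single 1 (a / Real.sqrt (1 + a ^ 2)) +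
        EuclideanSpace.single 2 (-1 / Real.sqrt (1 + a ^ 2)))
    (I : Set ℝ) (hI : IsOpen I)
    (ξ η ξ' η' ξ'' η'' : ℝ → ℝ)
    (hξ : ∀ t ∈ I, HasDerivAt ξ (ξ' t) t) (hξ' : ∀ t ∈ I, HasDerivAt ξ' (ξ'' t) t)
    (hη : ∀ t ∈ I, HasDerivAt η (η' t) t) (hη' : ∀ t ∈ I, HasDerivAt η' (η'' t) t)
    (hne : ∀ t ∈ I, (ξ t, η t) ≠ (0, 0))
    (hODEξ : ∀ t ∈ I, ξ'' t = -m * ξ t * (ξ t ^ 2 + η t ^ 2) ^ (-(3 : ℝ) / 2))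
    (hODEη : ∀ t ∈ I, η'' t = -m * η t * (ξ t ^ 2 + η t ^ 2) ^ (-(3 : ℝ) / 2))
    (q₁ : ℝ → EuclideanSpace ℝ (Fin 3))
    (hq₁ : ∀ t, q₁ t = EuclideanSpace.single 0 (ξ t) +
        EuclideanSpace.single 1 (Real.sqrt (1 + a ^ 2) * η t + a) +
        EuclideanSpace.single 2 (-1 : ℝ))
    (J : Set ℝ) (hJ : IsOpen J)
    (t : ℝ → ℝ) (htI : ∀ τ ∈ J, t τ ∈ I)
    (ht : ∀ τ ∈ J, HasDerivAt t (‖q₁ (t τ)‖ ^ 2) τ)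
    (q₂ : ℝ → EuclideanSpace ℝ (Fin 3))
    (hq₂ : ∀ τ, q₂ τ = (‖q₁ (t τ)‖)⁻¹ • q₁ (t τ)) :
    ∀ τ ∈ J,
      deriv (deriv q₂) τ =
        -(‖deriv q₂ τ‖ ^ 2) • q₂ τ +
          (m * Real.sqrt (1 + a ^ 2) * (1 - ⟪q₂ τ, Z₁⟫ ^ 2) ^ (-(3 : ℝ) / 2)) •
            (Z₁ - ⟪q₂ τ, Z₁⟫ • q₂ τ) := by
  intro τ hτ
  have hs2 : 0 < 1 + a ^ 2 := by positivity
  set s := Real.sqrt (1 + a ^ 2) with hs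
  have hsp : 0 < s := Real.sqrt_pos.2 hs2
  have hss : s ^ 2 = 1 + a ^ 2 := Real.sq_sqrt hs2.le
  have single_smul : ∀ (i : Fin 3) (x : ℝ),
      (EuclideanSpace.single i x : EuclideanSpace ℝ (Fin 3)) = x • EuclideanSpace.single i 1 := by
    intro i x
    ext j
    simp [Pi.single_apply]
  let V : ℝ → EuclideanSpace ℝ (Fin 3) := fun u =>
    ξ' u • EuclideanSpace.single 0 1 + (s * η' u) • EuclideanSpace.single 1 1
  let W : ℝ → EuclideanSpace ℝ (Fin 3) := fun u =>
    ξ'' u • EuclideanSpace.single 0 1 + (s * η'' u) • EuclideanSpace.single 1 1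
  have hQ : ∀ u ∈ I, HasDerivAt q₁ (V u) u := by
    intro u hu
    have e : q₁ = fun u => ξ u • (EuclideanSpace.single 0 1 : EuclideanSpace ℝ (Fin 3)) +
        (s * η u + a) • EuclideanSpace.single 1 1 + EuclideanSpace.single 2 (-1 : ℝ) := by
      funext u
      rw [hq₁, single_smul 0 (ξ u), single_smul 1 (_ + _)]
    rw [e]
    exact (((hξ u hu).smul_const _).add
      ((((hη u hu).const_mul s).add_const a).smul_const _)).add_const _
  have hV : ∀ u ∈ I, HasDerivAt V (W u) u := fun u hu =>
    ((hξ' u hu).smul_const _).add (((hη' u hu).const_mul s).smul_const _)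
  have h0 : ∀ u, q₁ u ≠ 0 := by
    intro u h
    have := congrArg (fun v : EuclideanSpace ℝ (Fin 3) => v 2) h
    rw [hq₁] at this
    simp at this
  rw [central_proj_aux q₁ V W I J hJ hQ hV h0 t htI ht q₂ hq₂ τ hτ]
  congr 1
  have hu := htI τ hτ
  have hxi := hODEξ _ hu
  have heta := hODEη _ hu
  have hn := hne _ hu
  rw [hq₂ τ]
  generalize t τ = u at *
  have hp := norm_pos_iff.2 (h0 u)
  have hρ : 0 < ξ u ^ 2 + η u ^ 2 := by
    by_contra hc
    apply hn
    have h1 : ξ u = 0 := by nlinarith [sq_nonneg (ξ u), sq_nonneg (η u)]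
    have h2 : η u = 0 := by nlinarith [sq_nonneg (ξ u), sq_nonneg (η u)]
    rw [h1, h2]
  have hN : ‖q₁ u‖ ^ 2 = ξ u ^ 2 + (s * η u + a) ^ 2 + 1 := by
    rw [EuclideanSpace.norm_sq_eq, hq₁]
    simp [Fin.sum_univ_three]
  have hQZ : ⟪q₁ u, Z₁⟫ = a * η u + s := by
    rw [hq₁, hZ₁]
    simp [PiLp.inner_apply, Fin.sum_univ_three]
    field_simp
    linear_combination -hss
  have hW : W u = (-(m * (ξ u ^ 2 + η u ^ 2) ^ (-(3 : ℝ) / 2))) • (q₁ u - s • Z₁) := by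
    simp only [W]
    rw [hq₁, hZ₁, hxi, heta]
    ext i
    fin_cases i <;> simp <;> field_simp <;> ring_nf <;> simp
  have hin : ⟪‖q₁ u‖⁻¹ • q₁ u, Z₁⟫ = ‖q₁ u‖⁻¹ * (a * η u + s) := by
    rw [real_inner_smul_left, hQZ]
  have h1m : 1 - (‖q₁ u‖⁻¹ * (a * η u + s)) ^ 2 = (ξ u ^ 2 + η u ^ 2) / ‖q₁ u‖ ^ 2 := by
    field_simp
    rw [hN]
    linear_combination (η u ^ 2 - 1) * hss
  have hpow : ((ξ u ^ 2 + η u ^ 2) / ‖q₁ u‖ ^ 2) ^ (-(3 : ℝ) / 2) =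
      (ξ u ^ 2 + η u ^ 2) ^ (-(3 : ℝ) / 2) * ‖q₁ u‖ ^ 3 := by
    rw [Real.div_rpow hρ.le (by positivity), div_eq_mul_inv, ← Real.rpow_neg (by positivity),
      ← Real.rpow_natCast ‖q₁ u‖ 2, ← Real.rpow_mul hp.le, ← Real.rpow_natCast ‖q₁ u‖ 3]
    norm_num
  rw [hin, h1m, hpow, hW, real_inner_smul_right, inner_sub_right, real_inner_smul_right, hQZ,
    real_inner_self_eq_norm_sq]
  generalize (ξ u ^ 2 + η u ^ 2) ^ (-(3 : ℝ) / 2) = k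
  ext i
  simp
  field_simp
  ring
end

section
/- For all a, m ∈ ℝ, there exists a point (ξ, η, ξ̇, η̇) with (ξ,η) ∈ ℝ² ∖ {(0,0)} at which the derivatives (differentials) of the smooth functions E_pl and E_sph on (ℝ² ∖ {(0,0)}) × ℝ² are linearly independent; that is, E_pl and E_sph are functionally independent first integrals. -/
/-- Functional independence of the planar and spherical energies: there is a point of the
phase space `(ℝ² ∖ {0}) × ℝ²` at which the differentials of `E_pl` and `E_sph` are
linearly independent. -/
theorem epl_esph_functionally_independent
    (a m : ℝ)
    (Epl Esph : (ℝ × ℝ) × (ℝ × ℝ) → ℝ)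
    (hEpl : ∀ p : (ℝ × ℝ) × (ℝ × ℝ),
      Epl p = (1 / 2) * (p.2.1 ^ 2 + p.2.2 ^ 2) -
        m * (p.1.1 ^ 2 + p.1.2 ^ 2) ^ (-(1 : ℝ) / 2))
    (hEsph : ∀ p : (ℝ × ℝ) × (ℝ × ℝ),
      Esph p =
        (1 + a ^ 2) * ((1 / 2) * (p.2.1 ^ 2 + p.2.2 ^ 2) -
            m * (p.1.1 ^ 2 + p.1.2 ^ 2) ^ (-(1 : ℝ) / 2)) +
          ((1 + a ^ 2) / 2) *
            ((p.1.1 * p.2.2 - p.1.2 * p.2.1) ^ 2 -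
              (2 * a / Real.sqrt (1 + a ^ 2)) *
                ((p.1.1 * p.2.2 - p.1.2 * p.2.1) * p.2.1 +
                  m * p.1.2 * (p.1.1 ^ 2 + p.1.2 ^ 2) ^ (-(1 : ℝ) / 2)))) :
    ∃ p : (ℝ × ℝ) × (ℝ × ℝ), p.1 ≠ (0, 0) ∧
      LinearIndependent ℝ ![fderiv ℝ Epl p, fderiv ℝ Esph p] := by
  have hE1 : Epl = _ := funext hEpl
  have hE2 : Esph = _ := funext hEsph
  have h0 : (((1:ℝ),(0:ℝ)),((1:ℝ),(1:ℝ))).1.1 ^ 2 + (((1:ℝ),(0:ℝ)),((1:ℝ),(1:ℝ))).1.2 ^ 2 ≠ 0 := by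
    norm_num
  have hr : DifferentiableAt ℝ (fun p : (ℝ × ℝ) × (ℝ × ℝ) =>
      (p.1.1 ^ 2 + p.1.2 ^ 2) ^ (-(1 : ℝ) / 2)) ((1, 0), (1, 1)) :=
    DifferentiableAt.rpow_const (by fun_prop) (Or.inl h0)
  have d1 : DifferentiableAt ℝ Epl ((1, 0), (1, 1)) := by
    rw [hE1]; fun_prop
  have d2 : DifferentiableAt ℝ Esph ((1, 0), (1, 1)) := by
    rw [hE2]; fun_prop
  have e1 : fderiv ℝ Epl ((1, 0), (1, 1)) ((0, 0), (1, -1)) = 0 := by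
    rw [← d1.lineDeriv_eq_fderiv, lineDeriv]
    have : (fun t : ℝ => Epl (((1, 0), (1, 1)) + t • ((0, 0), (1, -1)))) =
        fun t => t ^ 2 + (1 - m) := by
      funext t
      rw [hEpl]; simp; ring
    rw [this]
    simp
  have e2 : fderiv ℝ Esph ((1, 0), (1, 1)) ((0, 0), (1, -1)) = -(1 + a ^ 2) := by
    rw [← d2.lineDeriv_eq_fderiv, lineDeriv]
    have : (fun t : ℝ => Esph (((1, 0), (1, 1)) + t • ((0, 0), (1, -1)))) =
        fun t => (1 + a ^ 2) * (3 / 2 + a / Real.sqrt (1 + a ^ 2)) * t ^ 2 + (-(1 + a ^ 2) * t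
          + (1 + a ^ 2) * (3 / 2 - m - a / Real.sqrt (1 + a ^ 2))) := by
      funext t
      rw [hEsph]; simp; ring
    rw [this]
    have h := (((hasDerivAt_id (0:ℝ)).pow 2).const_mul
      ((1 + a ^ 2) * (3 / 2 + a / Real.sqrt (1 + a ^ 2)))).add
      (((hasDerivAt_id (0:ℝ)).const_mul (-(1 + a ^ 2))).add_const
        ((1 + a ^ 2) * (3 / 2 - m - a / Real.sqrt (1 + a ^ 2))))
    refine (HasDerivAt.deriv h).trans ?_
    simp
  have e3 : fderiv ℝ Epl ((1, 0), (1, 1)) ((0, 0), (1, 0)) = 1 := by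
    rw [← d1.lineDeriv_eq_fderiv, lineDeriv]
    have : (fun t : ℝ => Epl (((1, 0), (1, 1)) + t • ((0, 0), (1, 0)))) =
        fun t => (1 / 2) * t ^ 2 + (t + (1 - m)) := by
      funext t
      rw [hEpl]; simp; ring
    rw [this]
    have h := (((hasDerivAt_id (0:ℝ)).pow 2).const_mul (1 / 2 : ℝ)).add
      ((hasDerivAt_id (0:ℝ)).add_const (1 - m))
    refine (HasDerivAt.deriv h).trans ?_
    simp
  refine ⟨((1, 0), (1, 1)), by simp, ?_⟩
  rw [LinearIndependent.pair_iff]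
  intro s t hst
  have ht : t = 0 := by
    have h := DFunLike.congr_fun hst ((0, 0), (1, -1))
    simp only [ContinuousLinearMap.add_apply, ContinuousLinearMap.smul_apply, e1, e2, smul_eq_mul,
      ContinuousLinearMap.zero_apply] at h
    have hp : (1 + a ^ 2) ≠ 0 := by positivity
    have h' : t * (1 + a ^ 2) = 0 := by linarith
    exact (mul_eq_zero.mp h').resolve_right hp
  subst ht
  have h := DFunLike.congr_fun hst ((0, 0), (1, 0))
  simp only [ContinuousLinearMap.add_apply, ContinuousLinearMap.smul_apply, e3, smul_eq_mul,
      ContinuousLinearMap.zero_apply] at h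
  exact ⟨by linarith, rfl⟩
end

section
/- Let m ∈ ℝ and h ∈ ℝ. Let t₀ < t₁ < ⋯ < t_N and let q = (ξ, η) : [t₀, t_N] → ℝ² ∖ {(0,0)} be continuous, such that on each closed subinterval [t_{i−1}, t_i] the curve q is C² and solves the planar Kepler–Coulomb ODE with mass factor m, and at each interior node t_i (0 < i < N) the reflection law holds: η(t_i) = h and the one-sided derivatives satisfy ξ̇(t_i⁺) = ξ̇(t_i⁻), η̇(t_i⁺) = −η̇(t_i⁻). Then both E_pl(ξ,η,ξ̇,η̇) and D(ξ,η,ξ̇,η̇) (defined with this h) take one and the same constant value along the whole broken trajectory, i.e. on every subinterval the same constants. (Integrability of the Boltzmann billiard model: the Kepler billiard with a line wall {η = h} has the two functionally related conserved quantities E_pl and D.) -/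
theorem bb_const (f : ℝ → ℝ) (a b : ℝ) (hab : a < b)
    (hf : ∀ s ∈ Set.Icc a b, HasDerivWithinAt f 0 (Set.Icc a b) s) :
    ∀ s ∈ Set.Icc a b, f s = f a := by
  apply constant_of_derivWithin_zero
  · exact fun s hs => (hf s hs).differentiableWithinAt
  · exact fun s hs => (hf s (Set.Ico_subset_Icc_self hs)).derivWithin
      (uniqueDiffOn_Icc hab s (Set.Ico_subset_Icc_self hs))

theorem bb_deriv (m h : ℝ) (S : Set ℝ) (s : ℝ) (q v : ℝ → ℝ × ℝ) (w : ℝ × ℝ)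
    (hne : q s ≠ (0, 0))
    (hq : HasDerivWithinAt q (v s) S s) (hv : HasDerivWithinAt v w S s)
    (hw : w = (-m * ((q s).1 ^ 2 + (q s).2 ^ 2) ^ (-(3 : ℝ) / 2)) • q s) :
    HasDerivWithinAt (fun s => (1 / 2) * ((v s).1 ^ 2 + (v s).2 ^ 2) -
          m * ((q s).1 ^ 2 + (q s).2 ^ 2) ^ (-(1 : ℝ) / 2)) 0 S s ∧
    HasDerivWithinAt (fun s => ((q s).1 * (v s).2 - (q s).2 * (v s).1) ^ 2 -
          2 * h * (-((q s).1 * (v s).2 - (q s).2 * (v s).1) * (v s).1 -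
            m * (q s).2 * ((q s).1 ^ 2 + (q s).2 ^ 2) ^ (-(1 : ℝ) / 2))) 0 S s := by
  have hpos : 0 < (q s).1 ^ 2 + (q s).2 ^ 2 := by
    rcases eq_or_ne (q s).1 0 with h1 | h1
    · rcases eq_or_ne (q s).2 0 with h2 | h2
      · exact absurd (Prod.ext h1 h2) hne
      · positivity
    · positivity
  have hx : HasDerivWithinAt (fun s => (q s).1) (v s).1 S s := hq.fst
  have hy : HasDerivWithinAt (fun s => (q s).2) (v s).2 S s := hq.snd
  have ha : HasDerivWithinAt (fun s => (v s).1) w.1 S s := hv.fst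
  have hb : HasDerivWithinAt (fun s => (v s).2) w.2 S s := hv.snd
  have hR := ((hx.fun_pow 2).fun_add (hy.fun_pow 2)).rpow_const (p := -(1 : ℝ) / 2) (Or.inl hpos.ne')
  have hL := (hx.fun_mul hb).fun_sub (hy.fun_mul ha)
  have e1 : (-(1 : ℝ) / 2 - 1) = -(3 : ℝ) / 2 := by norm_num
  have e2 : ((q s).1 ^ 2 + (q s).2 ^ 2) ^ (-(1 : ℝ) / 2) =
      ((q s).1 ^ 2 + (q s).2 ^ 2) * ((q s).1 ^ 2 + (q s).2 ^ 2) ^ (-(3 : ℝ) / 2) := by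
    rw [← e1, Real.rpow_sub_one hpos.ne']
    field_simp
  have w1 : w.1 = (-m * ((q s).1 ^ 2 + (q s).2 ^ 2) ^ (-(3 : ℝ) / 2)) * (q s).1 := by
    rw [hw]; rfl
  have w2 : w.2 = (-m * ((q s).1 ^ 2 + (q s).2 ^ 2) ^ (-(3 : ℝ) / 2)) * (q s).2 := by
    rw [hw]; rfl
  rw [e1] at hR
  constructor
  · refine ((((ha.fun_pow 2).fun_add (hb.fun_pow 2)).const_mul (1 / 2)).fun_sub
      (hR.const_mul m)).congr_deriv ?_
    rw [w1, w2]
    generalize ((q s).1 ^ 2 + (q s).2 ^ 2) ^ (-(3 : ℝ) / 2) = R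
    push_cast
    ring
  · refine ((hL.fun_pow 2).fun_sub (((hL.fun_neg.fun_mul ha).fun_sub
      ((hy.const_mul m).fun_mul hR)).const_mul (2 * h))).congr_deriv ?_
    rw [w1, w2, e2]
    generalize ((q s).1 ^ 2 + (q s).2 ^ 2) ^ (-(3 : ℝ) / 2) = R
    push_cast
    ring

/-- Integrability of the Boltzmann billiard model: along any broken trajectory of the
Kepler billiard with wall the line `{η = h}` (Kepler–Coulomb dynamics with mass factor `m`
between impacts, velocity reflection `(ξ̇,η̇) ↦ (ξ̇,-η̇)` at impacts), both the energy
`E_pl` and the Gallavotti–Jauslin quantity `D = L² - 2hA_η` take one and the same constant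
value on the whole trajectory. -/
theorem boltzmann_billiard_integrable
    (m h : ℝ) (N : ℕ) (hN : 0 < N)
    (t : ℕ → ℝ) (hmono : ∀ i < N, t i < t (i + 1))
    (q : ℝ → ℝ × ℝ) (v w : ℕ → ℝ → ℝ × ℝ)
    (hcont : ContinuousOn q (Set.Icc (t 0) (t N)))
    (hne : ∀ s ∈ Set.Icc (t 0) (t N), q s ≠ (0, 0))
    (hq : ∀ i < N, ∀ s ∈ Set.Icc (t i) (t (i + 1)),
      HasDerivWithinAt q (v i s) (Set.Icc (t i) (t (i + 1))) s)
    (hv : ∀ i < N, ∀ s ∈ Set.Icc (t i) (t (i + 1)),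
      HasDerivWithinAt (v i) (w i s) (Set.Icc (t i) (t (i + 1))) s)
    (hODE : ∀ i < N, ∀ s ∈ Set.Icc (t i) (t (i + 1)),
      w i s = (-m * ((q s).1 ^ 2 + (q s).2 ^ 2) ^ (-(3 : ℝ) / 2)) • q s)
    (hwall : ∀ i, 0 < i → i < N →
      (q (t i)).2 = h ∧
      (v i (t i)).1 = (v (i - 1) (t i)).1 ∧
      (v i (t i)).2 = -(v (i - 1) (t i)).2) :
    ∃ c d : ℝ, ∀ i < N, ∀ s ∈ Set.Icc (t i) (t (i + 1)),
      (1 / 2) * ((v i s).1 ^ 2 + (v i s).2 ^ 2) -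
          m * ((q s).1 ^ 2 + (q s).2 ^ 2) ^ (-(1 : ℝ) / 2) = c ∧
      ((q s).1 * (v i s).2 - (q s).2 * (v i s).1) ^ 2 -
          2 * h * (-((q s).1 * (v i s).2 - (q s).2 * (v i s).1) * (v i s).1 -
            m * (q s).2 * ((q s).1 ^ 2 + (q s).2 ^ 2) ^ (-(1 : ℝ) / 2)) = d := by
  have ht0 : ∀ i ≤ N, t 0 ≤ t i := by
    intro i
    induction i with
    | zero => intro _; exact le_rfl
    | succ k ih => intro hk; exact (ih (by omega)).trans (hmono k (by omega)).le
  have htN : ∀ j i, i + j = N → t i ≤ t N := by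
    intro j
    induction j with
    | zero => intro i hi; rw [← hi]; exact le_rfl
    | succ k ih => intro i hi; exact (hmono i (by omega)).le.trans (ih (i + 1) (by omega))
  let E : ℕ → ℝ → ℝ := fun i s => (1 / 2) * ((v i s).1 ^ 2 + (v i s).2 ^ 2) -
          m * ((q s).1 ^ 2 + (q s).2 ^ 2) ^ (-(1 : ℝ) / 2)
  let D : ℕ → ℝ → ℝ := fun i s => ((q s).1 * (v i s).2 - (q s).2 * (v i s).1) ^ 2 -
          2 * h * (-((q s).1 * (v i s).2 - (q s).2 * (v i s).1) * (v i s).1 -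
            m * (q s).2 * ((q s).1 ^ 2 + (q s).2 ^ 2) ^ (-(1 : ℝ) / 2))
  have hder : ∀ i < N, ∀ s ∈ Set.Icc (t i) (t (i + 1)),
      HasDerivWithinAt (E i) 0 (Set.Icc (t i) (t (i + 1))) s ∧
      HasDerivWithinAt (D i) 0 (Set.Icc (t i) (t (i + 1))) s := by
    intro i hi s hs
    refine bb_deriv m h _ s q (v i) (w i s) (hne s ⟨(ht0 i hi.le).trans hs.1, hs.2.trans ?_⟩)
      (hq i hi s hs) (hv i hi s hs) (hODE i hi s hs)
    exact htN (N - (i + 1)) (i + 1) (by omega)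
  have hE : ∀ i < N, ∀ s ∈ Set.Icc (t i) (t (i + 1)), E i s = E i (t i) := fun i hi =>
    bb_const _ _ _ (hmono i hi) fun s hs => (hder i hi s hs).1
  have hD : ∀ i < N, ∀ s ∈ Set.Icc (t i) (t (i + 1)), D i s = D i (t i) := fun i hi =>
    bb_const _ _ _ (hmono i hi) fun s hs => (hder i hi s hs).2
  have key : ∀ i < N, E i (t i) = E 0 (t 0) ∧ D i (t i) = D 0 (t 0) := by
    intro i
    induction i with
    | zero => intro _; exact ⟨rfl, rfl⟩
    | succ k ih =>
      intro hk
      obtain ⟨i1, i2⟩ := ih (by omega)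
      have hm : t (k + 1) ∈ Set.Icc (t k) (t (k + 1)) := ⟨(hmono k (by omega)).le, le_rfl⟩
      obtain ⟨g1, g2, g3⟩ := hwall (k + 1) (by omega) hk
      simp only [Nat.add_sub_cancel] at g2 g3
      rw [← i1, ← i2, ← hE k (by omega) _ hm, ← hD k (by omega) _ hm]
      constructor
      · simp only [E, g2, g3]; ring
      · simp only [D, g1, g2, g3]; ring
  exact ⟨E 0 (t 0), D 0 (t 0), fun i hi s hs =>
    ⟨(hE i hi s hs).trans (key i hi).1, (hD i hi s hs).trans (key i hi).2⟩⟩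
end

section
/- Let a, m ∈ ℝ, μ = m√(1+a²), Z₁ = (0, a/√(1+a²), −1/√(1+a²)) ∈ S², and let e₂ = (0,1,0). Define, for q = (q_x,q_y,q_z) ∈ S² with q_z < 0 and q ≠ Z₁, and v ∈ ℝ³ tangent to S² at q: ξ = −q_x/q_z, η = (−q_y/q_z − a)/√(1+a²), ξ̇ = q_x v_z − q_z v_x, η̇ = (q_y v_z − q_z v_y)/√(1+a²), and G(q,v) = ½(ξ̇² + η̇²) − m (ξ²+η²)^{−1/2}; also define E(q,v) = ½|v|² − μ ⟨q,Z₁⟩ (1−⟨q,Z₁⟩²)^{−1/2}. Let τ₀ < τ₁ < ⋯ < τ_N and let q : [τ₀, τ_N] → S² be continuous with q_z < 0 and ⟨q,Z₁⟩ ≠ ±1 throughout, C² on each closed subinterval [τ_{i−1}, τ_i] where it solves the spherical Kepler–Coulomb ODE with mass factor μ and center Z₁, and at each interior node τ_i: q_y(τ_i) = 0 and the one-sided velocities satisfy v⁺ = v⁻ − 2⟨v⁻, e₂⟩ e₂. Then both E(q, q′) and G(q, q′) take one and the same constant value along the whole broken trajectory. (The spherical Kepler–Coulomb billiard with a great-circle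 wall is integrable.) -/
open scoped RealInnerProductSpace

theorem aux_const {α β : ℝ} {f : ℝ → ℝ}
    (h : ∀ s ∈ Set.Icc α β, HasDerivWithinAt f 0 (Set.Icc α β) s) :
    ∀ s ∈ Set.Icc α β, f s = f α := by
  intro s hs
  refine constant_of_derivWithin_zero (fun t ht => (h t ht).differentiableWithinAt) ?_ s hs
  intro t ht
  have hab : α < β := lt_of_le_of_lt ht.1 ht.2
  exact (h t ⟨ht.1, ht.2.le⟩).derivWithin (uniqueDiffOn_Icc hab t ⟨ht.1, ht.2.le⟩)

theorem aux_scalar (a m S α β : ℝ) (hab : α < β) (hS : 0 < S) (hS2 : S ^ 2 = 1 + a ^ 2)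
    (x y z x' y' z' x'' y'' z'' D : ℝ → ℝ)
    (hx : ∀ s ∈ Set.Icc α β, HasDerivWithinAt x (x' s) (Set.Icc α β) s)
    (hy : ∀ s ∈ Set.Icc α β, HasDerivWithinAt y (y' s) (Set.Icc α β) s)
    (hz : ∀ s ∈ Set.Icc α β, HasDerivWithinAt z (z' s) (Set.Icc α β) s)
    (hx' : ∀ s ∈ Set.Icc α β, HasDerivWithinAt x' (x'' s) (Set.Icc α β) s)
    (hy' : ∀ s ∈ Set.Icc α β, HasDerivWithinAt y' (y'' s) (Set.Icc α β) s)
    (hz' : ∀ s ∈ Set.Icc α β, HasDerivWithinAt z' (z'' s) (Set.Icc α β) s)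
    (hsph : ∀ s ∈ Set.Icc α β, x s ^ 2 + y s ^ 2 + z s ^ 2 = 1)
    (hD : ∀ s, D s = x s ^ 2 + ((y s + a * z s) / S) ^ 2)
    (hpos : ∀ s ∈ Set.Icc α β, 0 < D s)
    (V c : ℝ → ℝ) (hc : ∀ s, c s = (a * y s - z s) / S)
    (ex : ∀ s ∈ Set.Icc α β, x'' s = - V s * x s
      + (m * S * D s ^ (-(3 : ℝ) / 2)) * (0 - c s * x s))
    (ey : ∀ s ∈ Set.Icc α β, y'' s = - V s * y s
      + (m * S * D s ^ (-(3 : ℝ) / 2)) * (a / S - c s * y s))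
    (ez : ∀ s ∈ Set.Icc α β, z'' s = - V s * z s
      + (m * S * D s ^ (-(3 : ℝ) / 2)) * (-1 / S - c s * z s)) :
    (∀ s ∈ Set.Icc α β, HasDerivWithinAt (fun s => 1 / 2 * (x' s ^ 2 + y' s ^ 2 + z' s ^ 2)
        - m * S * c s * D s ^ (-(1 : ℝ) / 2)) 0 (Set.Icc α β) s) ∧
    (∀ s ∈ Set.Icc α β, HasDerivWithinAt (fun s => 1 / 2 * ((x s * z' s - z s * x' s) ^ 2
        + ((y s * z' s - z s * y' s) / S) ^ 2)
        + m * z s * D s ^ (-(1 : ℝ) / 2)) 0 (Set.Icc α β) s) := by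
  have key : ∀ s ∈ Set.Icc α β, x s * x' s + y s * y' s + z s * z' s = 0 := by
    intro s hs
    have h1 := (((hx s hs).pow 2).add ((hy s hs).pow 2)).add ((hz s hs).pow 2)
    have h2 : HasDerivWithinAt (x ^ 2 + y ^ 2 + z ^ 2) 0 (Set.Icc α β) s :=
      (hasDerivWithinAt_const s (Set.Icc α β) (1 : ℝ)).congr (fun t ht => by simpa using hsph t ht)
        (by simpa using hsph s hs)
    have h3 := (uniqueDiffOn_Icc hab s hs).eq_deriv _ h1 h2
    norm_num at h3
    linarith
  have hDd : ∀ s ∈ Set.Icc α β, HasDerivWithinAt D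
      (2 * (x s * x' s + (y s + a * z s) / S * ((y' s + a * z' s) / S))) (Set.Icc α β) s := by
    intro s hs
    have h1 := ((hx s hs).pow 2).add ((((hy s hs).add ((hz s hs).const_mul a)).div_const S).pow 2)
    have : D = x ^ 2 + (fun s => (y s + a * z s) / S) ^ 2 := by
      funext t; simp [hD t]
    rw [this]
    refine h1.congr_deriv ?_
    norm_num
    ring
  have hP : ∀ s ∈ Set.Icc α β, HasDerivWithinAt (fun s => D s ^ (-(1 : ℝ) / 2))
      (-(x s * x' s + (y s + a * z s) / S * ((y' s + a * z' s) / S)) * D s ^ (-(3 : ℝ) / 2))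
      (Set.Icc α β) s := by
    intro s hs
    have h1 := (hDd s hs).rpow_const (p := -(1 : ℝ) / 2) (Or.inl (hpos s hs).ne')
    convert h1 using 1
    rw [show (-(1 : ℝ) / 2 - 1) = -(3 : ℝ) / 2 by norm_num]
    ring
  have hDr : ∀ s ∈ Set.Icc α β, D s ^ (-(1 : ℝ) / 2) = D s * D s ^ (-(3 : ℝ) / 2) := by
    intro s hs
    nth_rewrite 2 [← Real.rpow_one (D s)]
    rw [← Real.rpow_add (hpos s hs)]
    norm_num
  have hcd : ∀ s ∈ Set.Icc α β, HasDerivWithinAt c ((a * y' s - z' s) / S) (Set.Icc α β) s := by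
    intro s hs
    have h1 := (((hy s hs).const_mul a).sub (hz s hs)).div_const S
    have : c = fun s => (a * y s - z s) / S := funext hc
    rw [this]
    exact h1
  constructor
  · intro s hs
    have h1 := (((((hx' s hs).pow 2).add ((hy' s hs).pow 2)).add ((hz' s hs).pow 2)).const_mul
      (1 / 2)).sub (((hcd s hs).const_mul (m * S)).mul (hP s hs))
    refine h1.congr_deriv ?_
    have hk := key s hs
    have hsp := hsph s hs
    rw [hDr s hs, ex s hs, ey s hs, ez s hs]
    simp only [Pi.mul_apply, Pi.sub_apply, Nat.cast_ofNat, Nat.add_one_sub_one, pow_one]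
    have hDs := hD s
    have hcs := hc s
    generalize D s ^ (-(3 : ℝ) / 2) = r at *
    have hcc : D s + c s ^ 2 = 1 := by
      rw [hDs, hcs, ← hsp]; field_simp; rw [hS2]; ring
    have hc' : x s * x' s + (y s + a * z s) / S * ((y' s + a * z' s) / S)
        = - c s * ((a * y' s - z' s) / S) := by
      rw [hcs, eq_comm, ← sub_eq_zero, ← neg_eq_zero, ← hk]; field_simp; rw [hS2]; ring
    linear_combination (-(V s + m * S * r * c s)) * hk
      - m * S * r * ((a * y' s - z' s) / S) * hcc + m * S * r * c s * hc'
  · intro s hs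
    have h1 := (((((hx s hs).mul (hz' s hs)).sub ((hz s hs).mul (hx' s hs))).pow 2).add
      (((((hy s hs).mul (hz' s hs)).sub ((hz s hs).mul (hy' s hs))).div_const S).pow 2)).const_mul
      (1 / 2) |>.add (((hz s hs).const_mul m).mul (hP s hs))
    refine h1.congr_deriv ?_
    rw [hDr s hs, ex s hs, ey s hs, ez s hs, hD s]
    simp only [Pi.mul_apply, Pi.sub_apply, Nat.cast_ofNat, Nat.add_one_sub_one, pow_one]
    generalize (x s ^ 2 + ((y s + a * z s) / S) ^ 2) ^ (-(3 : ℝ) / 2) = r at *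
    field_simp
    ring

/-- The spherical Kepler–Coulomb billiard with a great-circle wall (the great circle cut
by the plane `{y = 0}`) is integrable: along any broken trajectory both the spherical
energy `E` and the pulled-back planar energy `G` take one and the same constant value. -/
theorem spherical_great_circle_billiard_integrable
    (a m μ : ℝ) (hμ : μ = m * Real.sqrt (1 + a ^ 2))
    (Z₁ : EuclideanSpace ℝ (Fin 3))
    (hZ₁ : Z₁ = EuclideanSpace.single 1 (a / Real.sqrt (1 + a ^ 2)) +
        EuclideanSpace.single 2 (-1 / Real.sqrt (1 + a ^ 2)))
    (e₂ : EuclideanSpace ℝ (Fin 3)) (he₂ : e₂ = EuclideanSpace.single 1 (1 : ℝ))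
    (G E : EuclideanSpace ℝ (Fin 3) → EuclideanSpace ℝ (Fin 3) → ℝ)
    (hG : ∀ p u, G p u =
      (1 / 2) * ((p 0 * u 2 - p 2 * u 0) ^ 2 +
          ((p 1 * u 2 - p 2 * u 1) / Real.sqrt (1 + a ^ 2)) ^ 2) -
        m * ((-(p 0) / p 2) ^ 2 +
          ((-(p 1) / p 2 - a) / Real.sqrt (1 + a ^ 2)) ^ 2) ^ (-(1 : ℝ) / 2))
    (hE : ∀ p u, E p u =
      (1 / 2) * ‖u‖ ^ 2 - μ * ⟪p, Z₁⟫ * (1 - ⟪p, Z₁⟫ ^ 2) ^ (-(1 : ℝ) / 2))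
    (N : ℕ) (hN : 0 < N)
    (τ : ℕ → ℝ) (hmono : ∀ i < N, τ i < τ (i + 1))
    (q : ℝ → EuclideanSpace ℝ (Fin 3)) (v w : ℕ → ℝ → EuclideanSpace ℝ (Fin 3))
    (hcont : ContinuousOn q (Set.Icc (τ 0) (τ N)))
    (hsph : ∀ s ∈ Set.Icc (τ 0) (τ N), ‖q s‖ = 1)
    (hz : ∀ s ∈ Set.Icc (τ 0) (τ N), q s 2 < 0)
    (hcen : ∀ s ∈ Set.Icc (τ 0) (τ N), ⟪q s, Z₁⟫ ≠ 1 ∧ ⟪q s, Z₁⟫ ≠ -1)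
    (hq : ∀ i < N, ∀ s ∈ Set.Icc (τ i) (τ (i + 1)),
      HasDerivWithinAt q (v i s) (Set.Icc (τ i) (τ (i + 1))) s)
    (hv : ∀ i < N, ∀ s ∈ Set.Icc (τ i) (τ (i + 1)),
      HasDerivWithinAt (v i) (w i s) (Set.Icc (τ i) (τ (i + 1))) s)
    (hODE : ∀ i < N, ∀ s ∈ Set.Icc (τ i) (τ (i + 1)),
      w i s = -(‖v i s‖ ^ 2) • q s +
        (μ * (1 - ⟪q s, Z₁⟫ ^ 2) ^ (-(3 : ℝ) / 2)) • (Z₁ - ⟪q s, Z₁⟫ • q s))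
    (hwall : ∀ i, 0 < i → i < N →
      q (τ i) 1 = 0 ∧
      v i (τ i) = v (i - 1) (τ i) - (2 * ⟪v (i - 1) (τ i), e₂⟫) • e₂) :
    ∃ cE cG : ℝ, ∀ i < N, ∀ s ∈ Set.Icc (τ i) (τ (i + 1)),
      E (q s) (v i s) = cE ∧ G (q s) (v i s) = cG := by
  set S := Real.sqrt (1 + a ^ 2) with hSdef
  have hS : 0 < S := Real.sqrt_pos.mpr (by positivity)
  have hS2 : S ^ 2 = 1 + a ^ 2 := Real.sq_sqrt (by positivity)
  have hle : ∀ k j, j + k ≤ N → τ j ≤ τ (j + k) := by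
    intro k
    induction k with
    | zero => intro j _; exact le_rfl
    | succ k ih =>
      intro j hj
      exact (ih j (by omega)).trans (hmono (j + k) (by omega)).le
  have hsub : ∀ i < N, ∀ s ∈ Set.Icc (τ i) (τ (i + 1)), s ∈ Set.Icc (τ 0) (τ N) := by
    intro i hi s hs
    have h1 := hle i 0 (by omega)
    have h2 := hle (N - (i + 1)) (i + 1) (by omega)
    rw [Nat.zero_add] at h1
    rw [Nat.add_sub_cancel' hi] at h2
    exact ⟨h1.trans hs.1, hs.2.trans h2⟩
  have hc : ∀ p : EuclideanSpace ℝ (Fin 3), ⟪p, Z₁⟫ = (a * p 1 - p 2) / S := by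
    intro p
    rw [hZ₁, inner_add_right]
    simp [EuclideanSpace.inner_single_right]
    ring
  have hn : ∀ p : EuclideanSpace ℝ (Fin 3), ‖p‖ ^ 2 = p 0 ^ 2 + p 1 ^ 2 + p 2 ^ 2 := by
    intro p
    simp [EuclideanSpace.norm_sq_eq, Fin.sum_univ_three]
  have hn1 : ∀ s ∈ Set.Icc (τ 0) (τ N), q s 0 ^ 2 + q s 1 ^ 2 + q s 2 ^ 2 = 1 := by
    intro s hs
    rw [← hn, hsph s hs]; norm_num
  obtain ⟨D, hD⟩ : ∃ D : ℝ → ℝ, ∀ s, D s = q s 0 ^ 2 + ((q s 1 + a * q s 2) / S) ^ 2 :=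
    ⟨_, fun _ => rfl⟩
  have hDc : ∀ s ∈ Set.Icc (τ 0) (τ N), 1 - ⟪q s, Z₁⟫ ^ 2 = D s := by
    intro s hs
    rw [hc, hD, ← hn1 s hs]
    field_simp
    rw [hS2]
    ring
  have hpos : ∀ s ∈ Set.Icc (τ 0) (τ N), 0 < D s := by
    intro s hs
    have h0 : 0 ≤ D s := by rw [hD]; positivity
    refine lt_of_le_of_ne h0 ?_
    intro h
    have h1 := hDc s hs
    rw [← h] at h1
    have h2 : (⟪q s, Z₁⟫ - 1) * (⟪q s, Z₁⟫ + 1) = 0 := by linarith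
    rcases mul_eq_zero.mp h2 with h3 | h3
    · exact (hcen s hs).1 (by linarith)
    · exact (hcen s hs).2 (by linarith)
  have hE' : ∀ s ∈ Set.Icc (τ 0) (τ N), ∀ u : EuclideanSpace ℝ (Fin 3), E (q s) u =
      1 / 2 * (u 0 ^ 2 + u 1 ^ 2 + u 2 ^ 2)
        - m * S * ((a * q s 1 - q s 2) / S) * D s ^ (-(1 : ℝ) / 2) := by
    intro s hs u
    rw [hE, hDc s hs, hn, hc, hμ]
  have hG' : ∀ s ∈ Set.Icc (τ 0) (τ N), ∀ u : EuclideanSpace ℝ (Fin 3), G (q s) u =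
      1 / 2 * ((q s 0 * u 2 - q s 2 * u 0) ^ 2
        + ((q s 1 * u 2 - q s 2 * u 1) / S) ^ 2)
        + m * q s 2 * D s ^ (-(1 : ℝ) / 2) := by
    intro s hs u
    have hzs := hz s hs
    have h1 : (-(q s 0) / q s 2) ^ 2 + ((-(q s 1) / q s 2 - a) / S) ^ 2
        = D s / (- q s 2) ^ 2 := by
      rw [hD]
      have := hzs.ne
      field_simp
      ring
    have h2 : ((- q s 2) ^ 2) ^ (-(1 : ℝ) / 2) = (- q s 2)⁻¹ := by
      rw [← Real.rpow_natCast, ← Real.rpow_mul (by linarith), ← Real.rpow_neg_one]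
      norm_num
    rw [hG, h1, Real.div_rpow (hpos s hs).le (by positivity), h2]
    rw [div_inv_eq_mul]
    ring
  have hcomp : ∀ (f : ℝ → EuclideanSpace ℝ (Fin 3)) (f' : EuclideanSpace ℝ (Fin 3)) (A : Set ℝ)
      (s : ℝ), HasDerivWithinAt f f' A s → ∀ j, HasDerivWithinAt (fun t => f t j) (f' j) A s :=
    fun f f' A s h j =>
      (EuclideanSpace.proj j : EuclideanSpace ℝ (Fin 3) →L[ℝ] ℝ).hasFDerivAt.comp_hasDerivWithinAt s h
  have hseg : ∀ i < N, ∀ s ∈ Set.Icc (τ i) (τ (i + 1)),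
      E (q s) (v i s) = E (q (τ i)) (v i (τ i)) ∧ G (q s) (v i s) = G (q (τ i)) (v i (τ i)) := by
    intro i hi
    obtain ⟨h1, h2⟩ := aux_scalar a m S (τ i) (τ (i + 1)) (hmono i hi) hS hS2
      (fun s => q s 0) (fun s => q s 1) (fun s => q s 2)
      (fun s => v i s 0) (fun s => v i s 1) (fun s => v i s 2)
      (fun s => w i s 0) (fun s => w i s 1) (fun s => w i s 2) D
      (fun s hs => hcomp _ _ _ _ (hq i hi s hs) 0)
      (fun s hs => hcomp _ _ _ _ (hq i hi s hs) 1)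
      (fun s hs => hcomp _ _ _ _ (hq i hi s hs) 2)
      (fun s hs => hcomp _ _ _ _ (hv i hi s hs) 0)
      (fun s hs => hcomp _ _ _ _ (hv i hi s hs) 1)
      (fun s hs => hcomp _ _ _ _ (hv i hi s hs) 2)
      (fun s hs => hn1 s (hsub i hi s hs)) hD
      (fun s hs => hpos s (hsub i hi s hs))
      (fun s => ‖v i s‖ ^ 2) (fun s => (a * q s 1 - q s 2) / S) (fun _ => rfl)
      (by
        intro s hs
        have := hDc s (hsub i hi s hs)
        simp only [hODE i hi s hs, this, hμ]
        rw [hc, hZ₁]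
        simp)
      (by
        intro s hs
        have := hDc s (hsub i hi s hs)
        simp only [hODE i hi s hs, this, hμ]
        rw [hc, hZ₁]
        simp)
      (by
        intro s hs
        have := hDc s (hsub i hi s hs)
        simp only [hODE i hi s hs, this, hμ]
        rw [hc, hZ₁]
        simp)
    intro s hs
    have h0 : τ i ∈ Set.Icc (τ i) (τ (i + 1)) := ⟨le_rfl, (hmono i hi).le⟩
    rw [hE' s (hsub i hi s hs), hE' _ (hsub i hi _ h0), hG' s (hsub i hi s hs),
      hG' _ (hsub i hi _ h0)]
    exact ⟨aux_const h1 s hs, aux_const h2 s hs⟩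
  have hall : ∀ i < N, E (q (τ i)) (v i (τ i)) = E (q (τ 0)) (v 0 (τ 0)) ∧
      G (q (τ i)) (v i (τ i)) = G (q (τ 0)) (v 0 (τ 0)) := by
    intro i
    induction i with
    | zero => intro _; exact ⟨rfl, rfl⟩
    | succ i ih =>
      intro hi
      have hi' : i < N := by omega
      have hend : τ (i + 1) ∈ Set.Icc (τ i) (τ (i + 1)) := ⟨(hmono i hi').le, le_rfl⟩
      have hs := hsub i hi' _ hend
      obtain ⟨hy0, hr⟩ := hwall (i + 1) (by omega) hi
      rw [Nat.add_sub_cancel] at hr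
      obtain ⟨hA, hB⟩ := hseg i hi' _ hend
      obtain ⟨hA', hB'⟩ := ih hi'
      have c0 : v (i + 1) (τ (i + 1)) 0 = v i (τ (i + 1)) 0 := by
        rw [hr, he₂]; simp
      have c1 : v (i + 1) (τ (i + 1)) 1 = - v i (τ (i + 1)) 1 := by
        rw [hr, he₂]; simp [EuclideanSpace.inner_single_right]; ring
      have c2 : v (i + 1) (τ (i + 1)) 2 = v i (τ (i + 1)) 2 := by
        rw [hr, he₂]; simp
      rw [← hA', ← hB', ← hA, ← hB, hE' _ hs, hE' _ hs, hG' _ hs, hG' _ hs, c0, c1, c2, hy0]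
      constructor <;> ring
  exact ⟨_, _, fun i hi s hs =>
    ⟨(hseg i hi s hs).1.trans (hall i hi).1, (hseg i hi s hs).2.trans (hall i hi).2⟩⟩
end

section
/- Let h₂ ∈ ℝ³ and let q₁ : I → ℝ³ be a C² curve with λ(t) := ⟨h₂, q₁(t)⟩ > 0 for all t. Let τ ↦ t(τ) solve dt/dτ = λ(t)² and define q₂(τ) = q₁(t(τ))/λ(t(τ)). Then for all τ, d²q₂/dτ²(τ) = λ(t(τ))² ( λ(t(τ)) q̈₁(t(τ)) − ⟨h₂, q̈₁(t(τ))⟩ q₁(t(τ)) ). In particular, all velocity-dependent terms cancel and the reparametrized acceleration of the central projection depends only on the acceleration q̈₁. -/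
open scoped RealInnerProductSpace

/-- For the central projection `q₂ = q₁/⟨h₂,q₁⟩` with the time change `dt/dτ = ⟨h₂,q₁⟩²`,
all velocity-dependent terms cancel and the reparametrized acceleration depends only on
the acceleration of `q₁`:
`d²q₂/dτ² = λ² (λ q̈₁ - ⟨h₂, q̈₁⟩ q₁)` with `λ = ⟨h₂, q₁⟩`. -/
theorem central_projection_acceleration
    (h₂ : EuclideanSpace ℝ (Fin 3))
    (I : Set ℝ) (hI : IsOpen I)
    (q₁ q₁' q₁'' : ℝ → EuclideanSpace ℝ (Fin 3))
    (hq₁ : ∀ t ∈ I, HasDerivAt q₁ (q₁' t) t)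
    (hq₁' : ∀ t ∈ I, HasDerivAt q₁' (q₁'' t) t)
    (hpos : ∀ t ∈ I, 0 < ⟪h₂, q₁ t⟫)
    (J : Set ℝ) (hJ : IsOpen J)
    (t : ℝ → ℝ) (htI : ∀ τ ∈ J, t τ ∈ I)
    (ht : ∀ τ ∈ J, HasDerivAt t (⟪h₂, q₁ (t τ)⟫ ^ 2) τ)
    (q₂ : ℝ → EuclideanSpace ℝ (Fin 3))
    (hq₂ : ∀ τ, q₂ τ = (⟪h₂, q₁ (t τ)⟫)⁻¹ • q₁ (t τ)) :
    ∀ τ ∈ J,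
      deriv (deriv q₂) τ =
        (⟪h₂, q₁ (t τ)⟫ ^ 2) •
          (⟪h₂, q₁ (t τ)⟫ • q₁'' (t τ) - ⟪h₂, q₁'' (t τ)⟫ • q₁ (t τ)) := by
  have hin : ∀ (f : ℝ → EuclideanSpace ℝ (Fin 3)) (f' : EuclideanSpace ℝ (Fin 3)) (s : ℝ),
      HasDerivAt f f' s → HasDerivAt (fun s => ⟪h₂, f s⟫) ⟪h₂, f'⟫ s := by
    intro f f' s hf
    have := (hasDerivAt_const s h₂).inner ℝ hf
    simpa using this
  have h1 : ∀ τ ∈ J, HasDerivAt q₂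
      (⟪h₂, q₁ (t τ)⟫ • q₁' (t τ) - ⟪h₂, q₁' (t τ)⟫ • q₁ (t τ)) τ := by
    intro τ hτ
    have hp := (hpos _ (htI τ hτ)).ne'
    have ha : HasDerivAt (fun s => (⟪h₂, q₁ s⟫)⁻¹ • q₁ s) _ (t τ) :=
      ((hin _ _ _ (hq₁ _ (htI τ hτ))).fun_inv hp).fun_smul (hq₁ _ (htI τ hτ))
    have hb := ha.scomp τ (ht τ hτ)
    have he : q₂ = (fun s => (⟪h₂, q₁ s⟫)⁻¹ • q₁ s) ∘ t := funext hq₂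
    rw [he]
    refine hb.congr_deriv ?_
    match_scalars <;> field_simp
  intro τ hτ
  have hev : deriv q₂ =ᶠ[nhds τ]
      (fun s => ⟪h₂, q₁ s⟫ • q₁' s - ⟪h₂, q₁' s⟫ • q₁ s) ∘ t := by
    filter_upwards [hJ.mem_nhds hτ] with σ hσ
    exact (h1 σ hσ).deriv
  rw [hev.deriv_eq]
  have hd := hq₁ _ (htI τ hτ)
  have hd' := hq₁' _ (htI τ hτ)
  have hc : HasDerivAt (fun s => ⟪h₂, q₁ s⟫ • q₁' s - ⟪h₂, q₁' s⟫ • q₁ s) _ (t τ) :=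
    ((hin _ _ _ hd).fun_smul hd').fun_sub ((hin _ _ _ hd').fun_smul hd)
  rw [(hc.scomp τ (ht τ hτ)).deriv]
  module
end

section
/- Let q₁ : I → ℝ³ be a C² curve of the form q₁(t) = (x(t), y(t), −1), and set λ(t) = ‖q₁(t)‖ = √(1 + x(t)² + y(t)²). Let τ ↦ t(τ) solve dt/dτ = λ(t)² and define q₂(τ) = q₁(t(τ))/λ(t(τ)) ∈ S². Then for all τ, the component of d²q₂/dτ² tangent to S² at q₂ equals the tangential component of λ³ q̈₁: d²q₂/dτ² − ⟨d²q₂/dτ², q₂⟩ q₂ = λ³ q̈₁ − ⟨λ³ q̈₁, q₂⟩ q₂ (all quantities on the right evaluated at t(τ)). In particular, the normal discrepancy is a force of constraint, and any force field on the plane {z = −1} is transformed by central projection and the time change d/dτ = λ² d/dt into a tangential force field on the southern hemisphere. -/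
open scoped RealInnerProductSpace

/-- For the central projection `q₂ = q₁/‖q₁‖` of a curve in the plane `{z = -1}` to the
southern hemisphere, with the time change `dt/dτ = ‖q₁‖²`, the component of `d²q₂/dτ²`
tangent to the sphere at `q₂` equals the tangential component of `λ³ q̈₁`, `λ = ‖q₁‖`. -/
theorem central_projection_to_sphere_tangential_acceleration
    (I : Set ℝ) (hI : IsOpen I)
    (q₁ q₁' q₁'' : ℝ → EuclideanSpace ℝ (Fin 3))
    (hq₁ : ∀ t ∈ I, HasDerivAt q₁ (q₁' t) t)
    (hq₁' : ∀ t ∈ I, HasDerivAt q₁' (q₁'' t) t)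
    (hplane : ∀ t ∈ I, q₁ t 2 = -1)
    (J : Set ℝ) (hJ : IsOpen J)
    (t : ℝ → ℝ) (htI : ∀ τ ∈ J, t τ ∈ I)
    (ht : ∀ τ ∈ J, HasDerivAt t (‖q₁ (t τ)‖ ^ 2) τ)
    (q₂ : ℝ → EuclideanSpace ℝ (Fin 3))
    (hq₂ : ∀ τ, q₂ τ = (‖q₁ (t τ)‖)⁻¹ • q₁ (t τ)) :
    ∀ τ ∈ J,
      deriv (deriv q₂) τ - ⟪deriv (deriv q₂) τ, q₂ τ⟫ • q₂ τ =
        (‖q₁ (t τ)‖ ^ 3) • q₁'' (t τ) -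
          ⟪(‖q₁ (t τ)‖ ^ 3) • q₁'' (t τ), q₂ τ⟫ • q₂ τ := by
  have hne : ∀ s ∈ I, q₁ s ≠ 0 := by
    intro s hs h0
    have h := hplane s hs
    rw [h0] at h
    norm_num at h
  have hn0 : ∀ s ∈ I, ‖q₁ s‖ ≠ 0 := fun s hs => norm_ne_zero_iff.mpr (hne s hs)
  have hnorm : ∀ s ∈ I, HasDerivAt (fun s => ‖q₁ s‖) (⟪q₁ s, q₁' s⟫ / ‖q₁ s‖) s := by
    intro s hs
    have h1 := ((hq₁ s hs).norm_sq).sqrt (pow_ne_zero 2 (hn0 s hs))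
    simp only [Real.sqrt_sq (norm_nonneg _)] at h1
    refine h1.congr_deriv ?_
    have := hn0 s hs
    field_simp
  have hm : ∀ s ∈ I, ∃ c, HasDerivAt (fun s => ⟪q₁ s, q₁' s⟫ / ‖q₁ s‖) c s := fun s hs =>
    ⟨_, ((hq₁ s hs).inner ℝ (hq₁' s hs)).div (hnorm s hs) (hn0 s hs)⟩
  have hd1 : ∀ τ ∈ J, HasDerivAt q₂
      (‖q₁ (t τ)‖ • q₁' (t τ) - (⟪q₁ (t τ), q₁' (t τ)⟫ / ‖q₁ (t τ)‖) • q₁ (t τ)) τ := by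
    intro τ hτ
    have hs := htI τ hτ
    have h0 := hn0 _ hs
    have h := (((hnorm _ hs).inv h0).smul (hq₁ _ hs)).scomp τ (ht τ hτ)
    have e : q₂ = (fun s => (‖q₁ s‖)⁻¹ • q₁ s) ∘ t := funext hq₂
    rw [e]
    refine h.congr_deriv ?_
    simp only [Pi.inv_apply, smul_add, smul_smul]
    rw [sub_eq_add_neg, ← neg_smul]
    congr 2 <;> field_simp
  intro τ hτ
  have hs := htI τ hτ
  have h0 := hn0 _ hs
  obtain ⟨c, hc⟩ := hm _ hs
  have hd2 : deriv (deriv q₂) τ =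
      (‖q₁ (t τ)‖ ^ 3) • q₁'' (t τ) - (‖q₁ (t τ)‖ ^ 3 * c) • q₂ τ := by
    have e : deriv q₂ =ᶠ[nhds τ] (fun s => ‖q₁ s‖ • q₁' s -
        (⟪q₁ s, q₁' s⟫ / ‖q₁ s‖) • q₁ s) ∘ t := by
      filter_upwards [hJ.mem_nhds hτ] with u hu
      exact (hd1 u hu).deriv
    rw [e.deriv_eq]
    have h := (((hnorm _ hs).smul (hq₁' _ hs)).sub (hc.smul (hq₁ _ hs))).scomp τ (ht τ hτ)
    refine h.deriv.trans ?_
    rw [hq₂ τ, smul_smul]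
    have e2 : ‖q₁ (t τ)‖ ^ 3 * c * (‖q₁ (t τ)‖)⁻¹ = ‖q₁ (t τ)‖ ^ 2 * c := by field_simp
    rw [e2]
    module
  have hq : ⟪q₂ τ, q₂ τ⟫ = 1 := by
    rw [real_inner_self_eq_norm_sq, hq₂ τ, norm_smul, norm_inv, norm_norm, inv_mul_cancel₀ h0,
      one_pow]
  rw [hd2, inner_sub_left, real_inner_smul_left (q₂ τ), hq]
  module
end

section
/- Let a, m ∈ ℝ and let (ξ, η) : I → ℝ² ∖ {(0,0)} be a C² solution of the planar Kepler–Coulomb ODE with mass factor m: ξ̈ = −m ξ (ξ²+η²)^{−3/2}, η̈ = −m η (ξ²+η²)^{−3/2}. Then the function t ↦ E_sph(ξ(t), η(t), ξ̇(t), η̇(t)) is constant on I; that is, the energy of the corresponding spherical Kepler–Coulomb problem is a first integral of the planar Kepler–Coulomb problem. -/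
/-- The energy `E_sph` of the corresponding spherical Kepler–Coulomb problem is a first
integral of the planar Kepler–Coulomb problem: it is constant along every solution of the
planar Kepler–Coulomb ODE defined on an interval. -/
theorem esph_first_integral_of_planar_kepler
    (a m : ℝ)
    (I : Set ℝ) (hI : IsOpen I) (hI' : I.OrdConnected)
    (ξ η ξ' η' ξ'' η'' : ℝ → ℝ)
    (hξ : ∀ t ∈ I, HasDerivAt ξ (ξ' t) t) (hξ' : ∀ t ∈ I, HasDerivAt ξ' (ξ'' t) t)
    (hη : ∀ t ∈ I, HasDerivAt η (η' t) t) (hη' : ∀ t ∈ I, HasDerivAt η' (η'' t) t)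
    (hne : ∀ t ∈ I, (ξ t, η t) ≠ (0, 0))
    (hODEξ : ∀ t ∈ I, ξ'' t = -m * ξ t * (ξ t ^ 2 + η t ^ 2) ^ (-(3 : ℝ) / 2))
    (hODEη : ∀ t ∈ I, η'' t = -m * η t * (ξ t ^ 2 + η t ^ 2) ^ (-(3 : ℝ) / 2)) :
    ∃ c : ℝ, ∀ t ∈ I,
      (1 + a ^ 2) * ((1 / 2) * (ξ' t ^ 2 + η' t ^ 2) -
          m * (ξ t ^ 2 + η t ^ 2) ^ (-(1 : ℝ) / 2)) +
        ((1 + a ^ 2) / 2) *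
          ((ξ t * η' t - η t * ξ' t) ^ 2 -
            (2 * a / Real.sqrt (1 + a ^ 2)) *
              ((ξ t * η' t - η t * ξ' t) * ξ' t +
                m * η t * (ξ t ^ 2 + η t ^ 2) ^ (-(1 : ℝ) / 2))) = c := by
  have key : ∀ t ∈ I, HasDerivAt (fun t => (1 + a ^ 2) * ((1 / 2) * (ξ' t ^ 2 + η' t ^ 2) -
          m * (ξ t ^ 2 + η t ^ 2) ^ (-(1 : ℝ) / 2)) +
        ((1 + a ^ 2) / 2) *
          ((ξ t * η' t - η t * ξ' t) ^ 2 -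
            (2 * a / Real.sqrt (1 + a ^ 2)) *
              ((ξ t * η' t - η t * ξ' t) * ξ' t +
                m * η t * (ξ t ^ 2 + η t ^ 2) ^ (-(1 : ℝ) / 2)))) 0 t := by
    intro t ht
    have hs : 0 < ξ t ^ 2 + η t ^ 2 := by
      by_contra hc
      apply hne t ht
      have h1 : ξ t = 0 := by nlinarith [sq_nonneg (ξ t), sq_nonneg (η t)]
      have h2 : η t = 0 := by nlinarith [sq_nonneg (ξ t), sq_nonneg (η t)]
      rw [h1, h2]
    have dx := hξ t ht
    have dy := hη t ht
    have du := hξ' t ht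
    have dv := hη' t ht
    rw [hODEξ t ht] at du
    rw [hODEη t ht] at dv
    have hR : (ξ t ^ 2 + η t ^ 2) ^ (-(1 : ℝ) / 2)
        = (ξ t ^ 2 + η t ^ 2) * (ξ t ^ 2 + η t ^ 2) ^ (-(3 : ℝ) / 2) := by
      rw [← Real.rpow_one_add' hs.le (by norm_num)]
      norm_num
    have dR := ((dx.fun_pow 2).fun_add (dy.fun_pow 2)).rpow_const (p := -(1 : ℝ) / 2) (Or.inl hs.ne')
    have he : (-(1 : ℝ) / 2 - 1) = -(3 : ℝ) / 2 := by norm_num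
    rw [he] at dR
    have dL := (dx.fun_mul dv).fun_sub (dy.fun_mul du)
    have h := (((((du.fun_pow 2).fun_add (dv.fun_pow 2)).const_mul (1 / 2 : ℝ)).fun_sub
      (dR.const_mul m)).const_mul (1 + a ^ 2)).fun_add
      (((dL.fun_pow 2).fun_sub (((dL.fun_mul du).fun_add
        ((dy.const_mul m).fun_mul dR)).const_mul (2 * a / Real.sqrt (1 + a ^ 2)))).const_mul
        ((1 + a ^ 2) / 2))
    refine h.congr_deriv ?_
    rw [hR]
    generalize (ξ t ^ 2 + η t ^ 2) ^ (-(3 : ℝ) / 2) = Q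
    generalize 2 * a / Real.sqrt (1 + a ^ 2) = k
    push_cast
    ring
  obtain ⟨c, hc⟩ := hI.exists_is_const_of_deriv_eq_zero hI'.isPreconnected
    (fun t ht => (key t ht).differentiableAt.differentiableWithinAt)
    (fun t ht => (key t ht).deriv)
  exact ⟨c, fun t ht => hc t ht⟩
end
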